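/- arXiv:2307.08833 — 4 statements merged into one kernel-verified Lean document; each statement's English description precedes it below -/
import Mathlib

section
/- Let G = (V, Σ, R, S) be an admissible SLG with L(G) = {u} and m = |u|, and let w ∈ α(G). Then there exists δ ≥ 0 such that for every j ∈ [1..m], it holds u[j] = w[δ + 2j − 1]. -/
/-- A straight-line grammar (SLG) over terminal alphabet `T` with set of nonterminals `N`:
every nonterminal has exactly one production rule (symbols are `N ⊕ T`). -/
structure SLG (T : Type) (N : Type) where
  start : N
  rhs : N → List (N ⊕ T)

namespace SLG

variable {T N : Type}

/-- One rewriting step: replace one occurrence of a nonterminal by its right-hand side. -/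
def Produces (G : SLG T N) (x y : List (N ⊕ T)) : Prop :=
  ∃ (p q : List (N ⊕ T)) (X : N),
    x = p ++ Sum.inl X :: q ∧ y = p ++ G.rhs X ++ q

/-- The derivation relation of an SLG. -/
def Derives (G : SLG T N) : List (N ⊕ T) → List (N ⊕ T) → Prop :=
  Relation.ReflTransGen G.Produces

/-- `u` is the (necessarily unique) expansion `exp_G(X)` of the nonterminal `X`. -/
def IsExp (G : SLG T N) (X : N) (u : List T) : Prop :=
  G.Derives [Sum.inl X] (u.map Sum.inr)

/-- The language of an SLG; for an SLG it equals `{exp_G(S)}`. -/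
def language (G : SLG T N) : Set (List T) :=
  { u | G.IsExp G.start u }

/-- `Y` occurs in the parse tree of `X`. -/
def Reaches (G : SLG T N) : N → N → Prop :=
  Relation.ReflTransGen (fun X Y => Sum.inl Y ∈ G.rhs X)

/-- An SLG is admissible if every right-hand side consists of exactly two symbols and
every nonterminal occurs in the parse tree of the start symbol. -/
def Admissible (G : SLG T N) : Prop :=
  (∀ X, (G.rhs X).length = 2) ∧ (∀ X, G.Reaches G.start X)

/-- The size of an SLG: the total length of the right-hand sides of all its rules. -/
def size (G : SLG T N) [Fintype N] : ℕ :=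
  ∑ X : N, (G.rhs X).length

end SLG

section Alpha

variable {T N : Type} {n : ℕ}

/-- The auxiliary grammar `G'` over `Σ' = Σ ∪ {$_i : i ∈ [1..|V|]}` (modelled as `T ⊕ Fin n`):
the rule `N_i → A B` of `G` becomes `N_i → A $_i B`, where `N_i = e i`. -/
def SLG.primed (G : SLG T N) (e : Fin n ≃ N) : SLG (T ⊕ Fin n) N where
  start := G.start
  rhs X :=
    match G.rhs X with
    | [A, B] =>
        [Sum.map id Sum.inl A, Sum.inr (Sum.inr (e.symm X)), Sum.map id Sum.inl B]
    | l => l.map (Sum.map id Sum.inl)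

/-- The string `w ∈ α(G)` determined by the ordering `e` of the nonterminals and the
`G'`-expansions `expD`, namely `w = ⨀_{i=1..|V|} exp_{G'}(N_i) · #_{2i-1} · exp_{G'}(N_i) · #_{2i}`,
over the alphabet `Σ'' = Σ ∪ {$_i : i ∈ [1..|V|]} ∪ {#_i : i ∈ [1..2|V|]}` (modelled as
`T ⊕ Fin n ⊕ Fin (2n)`). -/
def alphaWord (e : Fin n ≃ N) (expD : N → List (T ⊕ Fin n)) :
    List (T ⊕ Fin n ⊕ Fin (2 * n)) :=
  (List.finRange n).flatMap fun i =>
    (expD (e i)).map (Sum.map id Sum.inl)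
      ++ Sum.inr (Sum.inr (⟨2 * i.val, by have := i.isLt; omega⟩ : Fin (2 * n)))
      :: (expD (e i)).map (Sum.map id Sum.inl)
      ++ [Sum.inr (Sum.inr (⟨2 * i.val + 1, by have := i.isLt; omega⟩ : Fin (2 * n)))]

end Alpha

namespace SLG

variable {T N : Type} {n : ℕ}

/-- A list of terminals admits no rewriting step. -/
theorem not_produces_terminals (G : SLG T N) (u : List T) (y : List (N ⊕ T)) :
    ¬ G.Produces (u.map Sum.inr) y := by
  rintro ⟨p, q, X, h, -⟩
  have hX : (Sum.inl X : N ⊕ T) ∈ u.map Sum.inr := by rw [h]; simp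
  simp at hX

theorem eq_of_derives_terminals {G : SLG T N} {u : List T} {y : List (N ⊕ T)}
    (h : G.Derives (u.map Sum.inr) y) : y = u.map Sum.inr := by
  rcases Relation.ReflTransGen.cases_head h with h | ⟨z, hz, -⟩
  · exact h.symm
  · exact absurd hz (G.not_produces_terminals u z)

/-- Rewriting steps of an SLG have the diamond property. -/
theorem Produces.diamond {G : SLG T N} {x y z : List (N ⊕ T)}
    (hy : G.Produces x y) (hz : G.Produces x z) :
    y = z ∨ ∃ w, G.Produces y w ∧ G.Produces z w := by
  obtain ⟨p, q, X, rfl, rfl⟩ := hy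
  obtain ⟨p', q', Y, h, rfl⟩ := hz
  rcases List.append_eq_append_iff.mp h with ⟨a, rfl, ha⟩ | ⟨a, rfl, ha⟩
  · cases a with
    | nil =>
      simp only [List.nil_append, List.cons.injEq, Sum.inl.injEq] at ha
      obtain ⟨rfl, rfl⟩ := ha
      simp
    | cons b a =>
      simp only [List.cons_append, List.cons.injEq] at ha
      obtain ⟨rfl, rfl⟩ := ha
      exact Or.inr ⟨p ++ G.rhs X ++ a ++ G.rhs Y ++ q',
        ⟨p ++ G.rhs X ++ a, q', Y, by simp, by simp⟩,
        ⟨p, a ++ G.rhs Y ++ q', X, by simp, by simp⟩⟩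
  · cases a with
    | nil =>
      simp only [List.nil_append, List.cons.injEq, Sum.inl.injEq] at ha
      obtain ⟨rfl, rfl⟩ := ha
      simp
    | cons b a =>
      simp only [List.cons_append, List.cons.injEq] at ha
      obtain ⟨rfl, rfl⟩ := ha
      exact Or.inr ⟨p' ++ G.rhs Y ++ a ++ G.rhs X ++ q,
        ⟨p', a ++ G.rhs X ++ q, Y, by simp, by simp⟩,
        ⟨p' ++ G.rhs Y ++ a, q, X, by simp, by simp⟩⟩

/-- The expansion of a nonterminal is unique. -/
theorem IsExp.unique {G : SLG T N} {X : N} {u v : List T}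
    (hu : G.IsExp X u) (hv : G.IsExp X v) : u = v := by
  obtain ⟨w, hw₁, hw₂⟩ := Relation.church_rosser
    (fun a b c hab hac => by
      rcases hab.diamond hac with rfl | ⟨d, hb, hc⟩
      · exact ⟨b, .refl, .refl⟩
      · exact ⟨d, .single hb, .single hc⟩) hu hv
  have h := (eq_of_derives_terminals hw₁).symm.trans (eq_of_derives_terminals hw₂)
  exact (List.map_injective_iff.mpr Sum.inr_injective) h

/-- `Interleaved x x'` says that `x'` is obtained from the nonempty list `x` by inserting
one separator `$_d` between any two consecutive symbols. -/
inductive Interleaved : List (N ⊕ T) → List (N ⊕ (T ⊕ Fin n)) → Prop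
  | single (a : N ⊕ T) : Interleaved [a] [Sum.map id Sum.inl a]
  | cons (a : N ⊕ T) (d : Fin n) {x : List (N ⊕ T)} {x' : List (N ⊕ (T ⊕ Fin n))} :
      Interleaved x x' → Interleaved (a :: x) (Sum.map id Sum.inl a :: Sum.inr (Sum.inr d) :: x')

theorem primed_rhs_of_eq {G : SLG T N} {X : N} {A B : N ⊕ T} (e : Fin n ≃ N)
    (h : G.rhs X = [A, B]) :
    (G.primed e).rhs X =
      [Sum.map id Sum.inl A, Sum.inr (Sum.inr (e.symm X)), Sum.map id Sum.inl B] := by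
  simp [primed, h]

/-- A rewriting step of the primed grammar on an interleaved list lifts to a step of `G`. -/
theorem Interleaved.exists_produces {G : SLG T N} (hG : ∀ X, (G.rhs X).length = 2)
    {e : Fin n ≃ N} {x : List (N ⊕ T)} {x' : List (N ⊕ (T ⊕ Fin n))} (h : Interleaved x x') :
    ∀ {y'}, (G.primed e).Produces x' y' → ∃ y, G.Produces x y ∧ Interleaved y y' := by
  induction h with
  | single a =>
    rintro y' ⟨p, q, X, hx, rfl⟩
    obtain ⟨A, B, hAB⟩ := List.length_eq_two.mp (hG X)
    rw [primed_rhs_of_eq e hAB]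
    cases p with
    | nil =>
      simp only [List.nil_append, List.cons.injEq] at hx
      obtain ⟨ha, rfl⟩ := hx
      obtain rfl : a = Sum.inl X := by cases a <;> simp_all
      exact ⟨[A, B], ⟨[], [], X, by simp, by simp [hAB]⟩, .cons A _ (.single B)⟩
    | cons b p => simp at hx
  | @cons a d x x' hx' ih =>
    rintro y' ⟨p, q, X, hx, rfl⟩
    match p with
    | [] =>
      obtain ⟨A, B, hAB⟩ := List.length_eq_two.mp (hG X)
      rw [primed_rhs_of_eq e hAB]
      simp only [List.nil_append, List.cons.injEq] at hx
      obtain ⟨ha, rfl⟩ := hx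
      obtain rfl : a = Sum.inl X := by cases a <;> simp_all
      exact ⟨A :: B :: x, ⟨[], x, X, by simp, by simp [hAB]⟩, .cons A _ (.cons B d hx')⟩
    | [b] => simp at hx
    | b :: c :: p =>
      simp only [List.cons_append, List.cons.injEq] at hx
      obtain ⟨rfl, rfl, rfl⟩ := hx
      obtain ⟨y, ⟨r, s, Y, rfl, rfl⟩, hy⟩ := ih ⟨p, q, X, rfl, rfl⟩
      exact ⟨a :: (r ++ G.rhs Y ++ s), ⟨a :: r, s, Y, by simp, by simp⟩, .cons a d hy⟩

theorem Interleaved.exists_derives {G : SLG T N} (hG : ∀ X, (G.rhs X).length = 2)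
    {e : Fin n ≃ N} {x : List (N ⊕ T)} {x' y' : List (N ⊕ (T ⊕ Fin n))}
    (h : Interleaved x x') (hd : (G.primed e).Derives x' y') :
    ∃ y, G.Derives x y ∧ Interleaved y y' := by
  induction hd with
  | refl => exact ⟨x, .refl, h⟩
  | tail _ hs ih =>
    obtain ⟨y, hy, hi⟩ := ih
    obtain ⟨z, hz, hi'⟩ := hi.exists_produces hG hs
    exact ⟨z, hy.tail hz, hi'⟩

/-- A list whose interleaving is terminal is terminal, and it occupies the even positions. -/
theorem Interleaved.exists_terminals {x : List (N ⊕ T)} {x' : List (N ⊕ (T ⊕ Fin n))}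
    (h : Interleaved x x') : ∀ {u' : List (T ⊕ Fin n)}, x' = u'.map Sum.inr →
      ∃ u : List T, x = u.map Sum.inr ∧
        ∀ (j : ℕ) (hj : j < u.length), u'[2 * j]? = some (Sum.inl u[j]) := by
  induction h with
  | single a =>
    intro u' hu
    match u' with
    | [] => simp at hu
    | [c] =>
      rcases a with a | a
      · simp at hu
      · obtain rfl : Sum.inl a = c := by simpa using hu
        exact ⟨[a], rfl, fun j hj => by
          obtain rfl : j = 0 := by simpa using hj
          simp⟩
    | b :: c :: u' => simp at hu
  | @cons a d x x' hx' ih =>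
    intro u' hu
    match u' with
    | [] => simp at hu
    | [c] => simp at hu
    | b :: c :: u' =>
      simp only [List.map_cons, List.cons.injEq] at hu
      obtain ⟨ha, -, hu⟩ := hu
      obtain ⟨u, rfl, hu⟩ := ih hu
      rcases a with a | a
      · simp at ha
      · obtain rfl : Sum.inl a = b := by simpa using ha
        refine ⟨a :: u, rfl, fun j hj => ?_⟩
        cases j with
        | zero => simp
        | succ j =>
          have := hu j (by simpa using hj)
          simpa [Nat.mul_succ] using this

/-- The expansion in `G` is found at the even positions of the expansion in the primed grammar. -/
theorem IsExp.getElem?_primed {G : SLG T N} (hG : ∀ X, (G.rhs X).length = 2) {e : Fin n ≃ N}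
    {X : N} {u : List T} {u' : List (T ⊕ Fin n)} (hu : G.IsExp X u)
    (hu' : (G.primed e).IsExp X u') (j : ℕ) (hj : j < u.length) :
    u'[2 * j]? = some (Sum.inl u[j]) := by
  obtain ⟨y, hy, hi⟩ := (Interleaved.single (n := n) (Sum.inl X : N ⊕ T)).exists_derives hG hu'
  obtain ⟨v, rfl, hv⟩ := hi.exists_terminals rfl
  obtain rfl := hu.unique hy
  exact hv j hj

end SLG

/-- `exp_{G'}(N_i)` is a factor of the word `alphaWord`. -/
theorem exists_alphaWord_eq {T N : Type} {n : ℕ} (e : Fin n ≃ N)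
    (expD : N → List (T ⊕ Fin n)) (X : N) :
    ∃ p q, alphaWord e expD = p ++ ((expD X).map (Sum.map id Sum.inl) ++ q) := by
  obtain ⟨l₁, l₂, h⟩ := List.append_of_mem (List.mem_finRange (e.symm X))
  unfold alphaWord
  rw [h, List.flatMap_append, List.flatMap_cons, Equiv.apply_symm_apply]
  simp only [List.append_assoc]
  exact ⟨_, _, rfl⟩

/-- Let `G` be an admissible SLG with `L(G) = {u}` (so `u = exp_G(S)`,
here `u = expn G.start`) and let `w ∈ α(G)`.  Then there exists `δ ≥ 0` such that for
every (here 0-indexed) position `j` of `u` it holds `u[j] = w[δ + 2j]` (which is the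
0-indexed form of the 1-indexed identity `u[j] = w[δ + 2j − 1]`). -/
theorem alpha_subsequence {T N : Type} [Fintype N] {n : ℕ} (e : Fin n ≃ N)
    (G : SLG T N) (hG : G.Admissible)
    (expn : N → List T) (hexpn : ∀ X, G.IsExp X (expn X))
    (hord : ∀ i j : Fin n, i ≤ j → (expn (e i)).length ≤ (expn (e j)).length)
    (expD : N → List (T ⊕ Fin n)) (hexpD : ∀ X, (G.primed e).IsExp X (expD X)) :
    ∃ δ : ℕ, ∀ (j : ℕ) (hj : j < (expn G.start).length),
      (alphaWord e expD)[δ + 2 * j]? = some (Sum.inl ((expn G.start)[j])) := by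
  obtain ⟨p, q, hw⟩ := exists_alphaWord_eq e expD G.start
  refine ⟨p.length, fun j hj => ?_⟩
  have h := (hexpn G.start).getElem?_primed hG.1 (hexpD G.start) j hj
  have hlt : 2 * j < (expD G.start).length := (List.getElem?_eq_some_iff.mp h).1
  rw [hw, List.getElem?_append_right (by omega), Nat.add_sub_cancel_left,
    List.getElem?_append_left (by simpa using hlt), List.getElem?_map, h]
  rfl
end

section
/- Let I ⊆ {1, …, |V|}, i ∈ {1, …, |V|}, and s = bexp_I(N_i). Then |s| is odd; for every p ∈ [1..⌈|s|/2⌉), the symbol s[2p] belongs to {$_j : j ∈ {1,…,i} \ I}; and for every p ∈ [1..⌈|s|/2⌉], the symbol s[2p−1] belongs to Σ ∪ {M_j : j ∈ {1,…,i} ∩ I}. -/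
section Bexp

variable {T N : Type} {n : ℕ}

/-- The bounded expansion `bexp_I`, computed with explicit fuel (for an acyclic grammar
with `n` nonterminals, fuel `n` always suffices).  The output symbols are symbols of the
grammar `G_I`: its nonterminals are `Option {i // i ∈ I}` (`some i` is `M_i`, `none` is `S`)
and its terminals are `Σ'' = T ⊕ Fin n ⊕ Fin (2n)` (terminals of `G`, dollars, hashes). -/
def bexpFuel (G : SLG T N) (e : Fin n ≃ N) (I : Finset (Fin n)) :
    ℕ → (N ⊕ T) → List ((Option {i : Fin n // i ∈ I}) ⊕ (T ⊕ Fin n ⊕ Fin (2 * n)))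
  | _, Sum.inr t => [Sum.inr (Sum.inl t)]
  | 0, Sum.inl _ => []
  | k + 1, Sum.inl X =>
    if h : e.symm X ∈ I then [Sum.inl (some ⟨e.symm X, h⟩)]
    else
      match G.rhs X with
      | [A, B] =>
          bexpFuel G e I k A
            ++ Sum.inr (Sum.inr (Sum.inl (e.symm X))) :: bexpFuel G e I k B
      | _ => []

/-- `bexp_I` applied to a symbol of `G`. -/
def bexp (G : SLG T N) (e : Fin n ≃ N) (I : Finset (Fin n)) (s : N ⊕ T) :
    List ((Option {i : Fin n // i ∈ I}) ⊕ (T ⊕ Fin n ⊕ Fin (2 * n))) :=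
  bexpFuel G e I n s

/-- The grammar `G_I`: nonterminals `{S} ∪ {M_i : i ∈ I}`, rules
`M_i → bexp_I(X) $_i bexp_I(Y)` (where `N_i → X Y` in `G`) and
`S → ⨀_{i=1..|V|} bexp_I(N_i) · #_{2i-1} · bexp_I(N_i) · #_{2i}`. -/
def GI (G : SLG T N) (e : Fin n ≃ N) (I : Finset (Fin n)) :
    SLG (T ⊕ Fin n ⊕ Fin (2 * n)) (Option {i : Fin n // i ∈ I}) where
  start := none
  rhs := fun
    | none => (List.finRange n).flatMap fun i =>
        bexp G e I (Sum.inl (e i))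
          ++ Sum.inr (Sum.inr (Sum.inr (⟨2 * i.val, by have := i.isLt; omega⟩ : Fin (2 * n))))
          :: bexp G e I (Sum.inl (e i))
          ++ [Sum.inr (Sum.inr (Sum.inr
                (⟨2 * i.val + 1, by have := i.isLt; omega⟩ : Fin (2 * n))))]
    | some j =>
        match G.rhs (e j.1) with
        | [A, B] =>
            bexp G e I A ++ Sum.inr (Sum.inr (Sum.inl j.1)) :: bexp G e I B
        | _ => []

end Bexp

namespace SLG

variable {T N : Type} {G : SLG T N}

theorem Produces.append_context {x y : List (N ⊕ T)} (h : G.Produces x y)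
    (l r : List (N ⊕ T)) : G.Produces (l ++ x ++ r) (l ++ y ++ r) := by
  obtain ⟨p, q, X, rfl, rfl⟩ := h
  exact ⟨l ++ p, q ++ r, X, by simp, by simp⟩

theorem Derives.append_context {x y : List (N ⊕ T)} (h : G.Derives x y)
    (l r : List (N ⊕ T)) : G.Derives (l ++ x ++ r) (l ++ y ++ r) := by
  induction h with
  | refl => exact Relation.ReflTransGen.refl
  | tail _ hstep ih => exact ih.tail (Produces.append_context hstep l r)

theorem Derives.append {x y z w : List (N ⊕ T)} (h : G.Derives x y) (h' : G.Derives z w) :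
    G.Derives (x ++ z) (y ++ w) := by
  have h₁ := h.append_context [] z
  have h₂ := h'.append_context y []
  simp only [List.nil_append, List.append_nil] at h₁ h₂
  exact h₁.trans h₂

/-- In a derivation of a terminal word, any chosen nonterminal may be rewritten first. -/
theorem Derives.expand_nonterminal {l : List (N ⊕ T)} {v : List T}
    (h : G.Derives l (v.map Sum.inr)) (p q : List (N ⊕ T)) (X : N)
    (hl : l = p ++ Sum.inl X :: q) : G.Derives (p ++ G.rhs X ++ q) (v.map Sum.inr) := by
  induction h using Relation.ReflTransGen.head_induction_on generalizing p q with
  | refl =>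
    have : (Sum.inl X : N ⊕ T) ∈ v.map Sum.inr := by simp [hl]
    simp at this
  | head hstep htail ih =>
    obtain ⟨p', q', X', rfl, rfl⟩ := hstep
    rcases List.append_eq_append_iff.1 hl with ⟨a, rfl, ha⟩ | ⟨a, rfl, ha⟩
    · rcases List.cons_eq_append_iff.1 ha with ⟨rfl, hb⟩ | ⟨b, rfl, rfl⟩
      · obtain ⟨hX, rfl⟩ := List.cons_eq_cons.1 hb
        cases Sum.inl_injective hX
        simpa [Derives] using htail
      · refine Relation.ReflTransGen.head ?_ (ih (p' ++ G.rhs X' ++ b) q (by simp))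
        exact ⟨p', b ++ G.rhs X ++ q, X', by simp, by simp⟩
    · rcases List.cons_eq_append_iff.1 ha with ⟨rfl, hb⟩ | ⟨b, rfl, rfl⟩
      · obtain ⟨hX, rfl⟩ := List.cons_eq_cons.1 hb
        cases Sum.inl_injective hX
        simpa [Derives] using htail
      · refine Relation.ReflTransGen.head ?_ (ih p (b ++ G.rhs X' ++ q') (by simp))
        exact ⟨p ++ G.rhs X ++ b, q', X', by simp, by simp⟩

theorem Derives.terminal_unique {l : List (N ⊕ T)} {u v : List T}
    (hu : G.Derives l (u.map Sum.inr)) (hv : G.Derives l (v.map Sum.inr)) : u = v := by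
  induction hu using Relation.ReflTransGen.head_induction_on with
  | refl =>
    rcases Relation.ReflTransGen.cases_head hv with h | ⟨_, ⟨p, q, X, hX, _⟩, _⟩
    · exact List.map_injective_iff.2 Sum.inr_injective h
    · have : (Sum.inl X : N ⊕ T) ∈ u.map Sum.inr := by simp [hX]
      simp at this
  | head hstep _ ih =>
    obtain ⟨p, q, X, rfl, rfl⟩ := hstep
    exact ih (hv.expand_nonterminal p q X rfl)

theorem Derives.length_le (hG : ∀ X, 0 < (G.rhs X).length) {x y : List (N ⊕ T)}
    (h : G.Derives x y) : x.length ≤ y.length := by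
  induction h with
  | refl => exact le_rfl
  | tail _ hstep ih =>
    obtain ⟨p, q, X, rfl, rfl⟩ := hstep
    have := hG X
    simp only [List.length_append, List.length_cons] at ih ⊢
    omega

theorem IsExp.length_lt_of_mem_rhs (hG : ∀ X, (G.rhs X).length = 2)
    {expn : N → List T} (hexpn : ∀ X, G.IsExp X (expn X)) {X Y : N}
    (hY : Sum.inl Y ∈ G.rhs X) : (expn Y).length < (expn X).length := by
  have hpos : ∀ Z, 0 < (G.rhs Z).length := fun Z => by simp [hG Z]
  have hsymbol : ∀ s : N ⊕ T, ∃ u : List T, 0 < u.length ∧ G.Derives [s] (u.map Sum.inr) := by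
    rintro (Z | t)
    · refine ⟨expn Z, ?_, hexpn Z⟩
      have := (hexpn Z).length_le hpos
      simp only [List.length_map, List.length_singleton] at this
      omega
    · exact ⟨[t], by simp, Relation.ReflTransGen.refl⟩
  obtain ⟨A, B, hAB⟩ := List.length_eq_two.1 (hG X)
  obtain ⟨a, ha, hA⟩ := hsymbol A
  obtain ⟨b, hb, hB⟩ := hsymbol B
  have hrhs : G.Derives (G.rhs X) (expn X |>.map Sum.inr) := by
    simpa using (hexpn X).expand_nonterminal [] [] X rfl
  have hX : expn X = a ++ b :=
    hrhs.terminal_unique (by simpa [hAB] using hA.append hB)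
  rw [hAB] at hY
  rcases List.mem_pair.1 hY with rfl | rfl
  · rw [hX, (hexpn Y).terminal_unique hA, List.length_append]
    omega
  · rw [hX, (hexpn Y).terminal_unique hB, List.length_append]
    omega

end SLG

/-- A list of odd length whose entries at odd positions (counting from `0`) satisfy `P` and whose
entries at even positions satisfy `Q`. -/
def List.IsAlternating {α : Type} (P Q : α → Prop) (l : List α) : Prop :=
  l.length % 2 = 1 ∧ ∀ (q : ℕ) (hq : q < l.length), (q % 2 = 1 → P l[q]) ∧ (q % 2 = 0 → Q l[q])

namespace List.IsAlternating

variable {α : Type} {P Q P' Q' : α → Prop} {l r : List α} {c : α}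

theorem singleton (hc : Q c) : [c].IsAlternating P Q := by
  refine ⟨rfl, fun q hq => ?_⟩
  obtain rfl : q = 0 := by simpa using hq
  simpa using hc

theorem mono (h : l.IsAlternating P Q) (hP : ∀ a, P a → P' a) (hQ : ∀ a, Q a → Q' a) :
    l.IsAlternating P' Q' :=
  ⟨h.1, fun q hq => ⟨fun hq' => hP _ ((h.2 q hq).1 hq'), fun hq' => hQ _ ((h.2 q hq).2 hq')⟩⟩

theorem append_cons (hl : l.IsAlternating P Q) (hc : P c) (hr : r.IsAlternating P Q) :
    (l ++ c :: r).IsAlternating P Q := by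
  obtain ⟨hl₁, hl₂⟩ := hl
  obtain ⟨hr₁, hr₂⟩ := hr
  refine ⟨by simp only [List.length_append, List.length_cons]; omega, fun q hq => ?_⟩
  simp only [List.length_append, List.length_cons] at hq
  rcases lt_trichotomy q l.length with h | h | h
  · rw [List.getElem_append_left h]
    exact hl₂ q h
  · subst h
    simp [hl₁, hc]
  · obtain ⟨m, rfl⟩ : ∃ m, q = l.length + (m + 1) := ⟨q - l.length - 1, by omega⟩
    have hm := hr₂ m (by omega)
    rw [List.getElem_append_right (by omega)]
    simp only [Nat.add_sub_cancel_left, List.getElem_cons_succ]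
    exact ⟨fun h' => hm.1 (by omega), fun h' => hm.2 (by omega)⟩

end List.IsAlternating

section Bexp

variable {T N : Type} {n : ℕ}

/-- The symbol is a dollar `$_j` with `j ≤ i` and `j ∉ I`. -/
def IsDollarUpTo (I : Finset (Fin n)) (i : Fin n)
    (a : (Option {i : Fin n // i ∈ I}) ⊕ (T ⊕ Fin n ⊕ Fin (2 * n))) : Prop :=
  ∃ j : Fin n, j ≤ i ∧ j ∉ I ∧ a = Sum.inr (Sum.inr (Sum.inl j))

/-- The symbol is a terminal of the original grammar or some `M_j` with `j ≤ i`. -/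
def IsTerminalOrMarkUpTo (I : Finset (Fin n)) (i : Fin n)
    (a : (Option {i : Fin n // i ∈ I}) ⊕ (T ⊕ Fin n ⊕ Fin (2 * n))) : Prop :=
  (∃ t : T, a = Sum.inr (Sum.inl t)) ∨
    ∃ (j : Fin n) (hj : j ∈ I), j ≤ i ∧ a = Sum.inl (some ⟨j, hj⟩)

theorem bexpFuel_isAlternating {e : Fin n ≃ N} {G : SLG T N}
    (hG : ∀ X, (G.rhs X).length = 2)
    (hlt : ∀ i j : Fin n, Sum.inl (e j) ∈ G.rhs (e i) → j < i) (I : Finset (Fin n))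
    (k : ℕ) (i : Fin n) (hik : i.val < k) :
    (bexpFuel G e I k (Sum.inl (e i))).IsAlternating
      (IsDollarUpTo I i) (IsTerminalOrMarkUpTo I i) := by
  induction k generalizing i with
  | zero => omega
  | succ k ih =>
    rw [bexpFuel]
    split_ifs with h
    · exact .singleton (Or.inr ⟨_, h, by simp, rfl⟩)
    · have hsymbol : ∀ s ∈ G.rhs (e i), (bexpFuel G e I k s).IsAlternating
          (IsDollarUpTo I i) (IsTerminalOrMarkUpTo I i) := by
        rintro (Y | t) hs
        · obtain ⟨j, rfl⟩ := e.surjective Y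
          have hj : j < i := hlt i j hs
          refine (ih j (by have := Fin.lt_def.1 hj; omega)).mono ?_ ?_
          · rintro _ ⟨m, hm, hmI, rfl⟩
            exact ⟨m, hm.trans hj.le, hmI, rfl⟩
          · rintro _ (⟨t, rfl⟩ | ⟨m, hmI, hm, rfl⟩)
            · exact Or.inl ⟨t, rfl⟩
            · exact Or.inr ⟨m, hmI, hm.trans hj.le, rfl⟩
        · rw [bexpFuel]
          exact .singleton (Or.inl ⟨t, rfl⟩)
      obtain ⟨A, B, hAB⟩ := List.length_eq_two.1 (hG (e i))
      rw [hAB] at hsymbol ⊢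
      exact (hsymbol A (by simp)).append_cons ⟨_, by simp, h, rfl⟩ (hsymbol B (by simp))

end Bexp

/-- Let `I ⊆ {1, …, |V|}`, `i ∈ {1, …, |V|}` and `s = bexp_I(N_i)`.
Then `|s|` is odd; every symbol of `s` at an even 1-indexed position (i.e. at an odd
0-indexed position `q`) is a dollar `$_j` with `j ∈ {1,…,i} \ I`, and every symbol at an
odd 1-indexed position (even 0-indexed position) belongs to `Σ ∪ {M_j : j ∈ {1,…,i} ∩ I}`. -/
theorem bexp_dollars {T N : Type} [Fintype N] {n : ℕ} (e : Fin n ≃ N)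
    (G : SLG T N) (hG : G.Admissible)
    (expn : N → List T) (hexpn : ∀ X, G.IsExp X (expn X))
    (hord : ∀ i j : Fin n, i ≤ j → (expn (e i)).length ≤ (expn (e j)).length)
    (I : Finset (Fin n)) (i : Fin n) :
    (bexp G e I (Sum.inl (e i))).length % 2 = 1 ∧
    ∀ (q : ℕ) (hq : q < (bexp G e I (Sum.inl (e i))).length),
      (q % 2 = 1 →
        ∃ j : Fin n, j ≤ i ∧ j ∉ I ∧
          (bexp G e I (Sum.inl (e i)))[q] = Sum.inr (Sum.inr (Sum.inl j))) ∧
      (q % 2 = 0 →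
        (∃ t : T, (bexp G e I (Sum.inl (e i)))[q] = Sum.inr (Sum.inl t)) ∨
        (∃ (j : Fin n) (hj : j ∈ I), j ≤ i ∧
          (bexp G e I (Sum.inl (e i)))[q] = Sum.inl (some ⟨j, hj⟩))) := by
  exact bexpFuel_isAlternating hG.1
    (fun i j h => not_le.1 fun hij =>
      (SLG.IsExp.length_lt_of_mem_rhs hG.1 hexpn h).not_ge (hord i j hij))
    I n i i.isLt
end

section
/- Let I ⊆ {1, …, |V|}. There exists a maximal string with respect to the grammar G_I if and only if I ≠ {1, …, |V|}. -/
section Greedy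

variable {A B : Type}

/-- The number of non-overlapping occurrences of `p` in a list, found by the greedy
left-to-right scan (after finding an occurrence at position `i`, the search resumes at
position `i + |p|`). -/
def greedyCount [DecidableEq A] (p : List A) : List A → ℕ
  | [] => 0
  | a :: t =>
    if p ≠ [] ∧ p <+: (a :: t) then 1 + greedyCount p (t.drop (p.length - 1))
    else greedyCount p t
termination_by l => l.length
decreasing_by
  · simp only [List.length_drop, List.length_cons]; omega
  · simp only [List.length_cons]; omega

/-- Replace the greedily found non-overlapping occurrences of `p` in a list by the single
symbol `c`, mapping all remaining symbols by `f`. -/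
def greedyReplace [DecidableEq A] (p : List A) (c : B) (f : A → B) : List A → List B
  | [] => []
  | a :: t =>
    if p ≠ [] ∧ p <+: (a :: t) then c :: greedyReplace p c f (t.drop (p.length - 1))
    else f a :: greedyReplace p c f t
termination_by l => l.length
decreasing_by
  · simp only [List.length_drop, List.length_cons]; omega
  · simp only [List.length_cons]; omega

end Greedy

namespace SLG

variable {T N : Type}

/-- Total number of non-overlapping occurrences of the string `s` on the right-hand side
of the grammar `H` (greedy left-to-right scan of the definition of every nonterminal). -/
def rhsOccs [Fintype N] [DecidableEq N] [DecidableEq T] (H : SLG T N)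
    (s : List (N ⊕ T)) : ℕ :=
  ∑ X : N, greedyCount s (H.rhs X)

/-- `s` is a maximal string with respect to the grammar `H`: it has length at least two,
it has at least two non-overlapping occurrences on the right-hand side of `H`, and no
strictly longer string has at least as many non-overlapping occurrences. -/
def IsMaximal [Fintype N] [DecidableEq N] [DecidableEq T] (H : SLG T N)
    (s : List (N ⊕ T)) : Prop :=
  2 ≤ s.length ∧ 2 ≤ H.rhsOccs s ∧
    ∀ s' : List (N ⊕ T), s.length < s'.length → H.rhsOccs s' < H.rhsOccs s

/-- A single step of a global algorithm on `H` with chosen maximal string `s`: a fresh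
nonterminal (modelled by `none : Option N`) gets `s` as its definition, and the
non-overlapping occurrences of `s` (greedy left-to-right scan) on every right-hand side
are replaced by it. -/
def globalStep [DecidableEq N] [DecidableEq T] (H : SLG T N) (s : List (N ⊕ T)) :
    SLG T (Option N) where
  start := some H.start
  rhs := fun
    | some X => greedyReplace s (Sum.inl none) (Sum.map some id) (H.rhs X)
    | none => s.map (Sum.map some id)

/-- Isomorphism of SLGs over a common terminal alphabet: a bijection of the nonterminals
(extended by the identity on terminals) mapping start symbol to start symbol and the
right-hand side of every nonterminal symbol-by-symbol onto the right-hand side of its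
image. -/
def Isomorphic {N₁ N₂ : Type} (H₁ : SLG T N₁) (H₂ : SLG T N₂) : Prop :=
  ∃ g : N₁ ≃ N₂, g H₁.start = H₂.start ∧
    ∀ X, H₂.rhs (g X) = (H₁.rhs X).map (Sum.map g id)

/-- Renaming the nonterminals of an SLG along a bijection. -/
def relabel {N₁ N₂ : Type} (H : SLG T N₁) (g : N₁ ≃ N₂) : SLG T N₂ where
  start := g H.start
  rhs Y := (H.rhs (g.symm Y)).map (Sum.map g id)

end SLG

/-- The initial grammar of a global algorithm on the input string `w`: a single
nonterminal whose definition is `w`. -/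
def initSLG {T : Type} (w : List T) : SLG T (Fin 1) where
  start := 0
  rhs _ := w.map Sum.inr

/-- `Gs` is (the trace of) a run of `K` steps of a global algorithm on the input
string `w`: it starts with the one-rule grammar for `w` and each step replaces some
maximal string of the current grammar (after each step the nonterminals are renamed to
`Fin (k + 2)`, which keeps a uniform indexing and does not change the grammar up to
isomorphism). -/
def IsGlobalRun {T : Type} [DecidableEq T] (w : List T) (K : ℕ)
    (Gs : (k : ℕ) → SLG T (Fin (k + 1))) : Prop :=
  Gs 0 = initSLG w ∧
  ∀ k < K, ∃ s, (Gs k).IsMaximal s ∧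
    Gs (k + 1) = ((Gs k).globalStep s).relabel (finSuccEquiv (k + 1)).symm

section GreedyCount

variable {A : Type} [DecidableEq A] {p : List A}

theorem greedyCount_append_self (hp : p ≠ []) (r : List A) :
    greedyCount p (p ++ r) = 1 + greedyCount p r := by
  cases p with
  | nil => exact absurd rfl hp
  | cons a q =>
    rw [List.cons_append, greedyCount, if_pos ⟨hp, List.prefix_append (a :: q) r⟩]
    simp

theorem greedyCount_cons_eq_tail {a : A} {t : List A} (h : ¬ p <+: a :: t) :
    greedyCount p (a :: t) = greedyCount p t := by
  rw [greedyCount, if_neg fun h' => h h'.2]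

theorem greedyCount_drop_bounds (hp : p ≠ []) (l : List A) :
    (∀ k, greedyCount p (l.drop k) ≤ greedyCount p l) ∧
      ∀ k ≤ p.length, greedyCount p l ≤ 1 + greedyCount p (l.drop k) := by
  induction hm : l.length using Nat.strong_induction_on generalizing l with
  | _ m ih =>
    subst hm
    have hpos : 0 < p.length := List.length_pos_iff.2 hp
    by_cases h : p <+: l
    · obtain ⟨r, rfl⟩ := h
      rw [greedyCount_append_self hp]
      have hr := ih r.length (by simp; omega) r rfl
      have bound : ∀ k, greedyCount p ((p ++ r).drop (k + 1)) ≤ 1 + greedyCount p r := by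
        intro k
        rcases le_total (k + 1) p.length with hk | hk
        · have h1 := (ih ((p ++ r).drop (k + 1)).length (by simp; omega) _ rfl).2
            (p.length - (k + 1)) (by omega)
          rwa [List.drop_drop, Nat.add_sub_cancel' hk, List.drop_left] at h1
        · rw [List.drop_append, List.drop_eq_nil_of_le hk, List.nil_append]
          exact (hr.1 _).trans (Nat.le_add_left _ _)
      refine ⟨fun k => ?_, fun k hk => ?_⟩
      · cases k with
        | zero => rw [List.drop_zero, greedyCount_append_self hp]
        | succ k => exact bound k
      · cases k with
        | zero => rw [List.drop_zero, greedyCount_append_self hp]; omega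
        | succ k =>
          have h1 := (ih ((p ++ r).drop (k + 1)).length (by simp; omega) _ rfl).1
            (p.length - (k + 1))
          rw [List.drop_drop, Nat.add_sub_cancel' hk, List.drop_left] at h1
          omega
    · cases l with
      | nil => simp
      | cons a t =>
        rw [greedyCount_cons_eq_tail h]
        have ht := ih t.length (by simp) t rfl
        refine ⟨fun k => ?_, fun k hk => ?_⟩
        · cases k with
          | zero => rw [List.drop_zero, greedyCount_cons_eq_tail h]
          | succ k => simpa using ht.1 k
        · cases k with
          | zero => rw [List.drop_zero, greedyCount_cons_eq_tail h]; omega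
          | succ k => simpa using ht.2 k (by omega)

theorem greedyCount_le_append_left (hp : p ≠ []) (l r : List A) :
    greedyCount p r ≤ greedyCount p (l ++ r) := by
  simpa using (greedyCount_drop_bounds hp (l ++ r)).1 l.length

theorem two_le_greedyCount (hp : p ≠ []) (u v w : List A) :
    2 ≤ greedyCount p (u ++ (p ++ (v ++ (p ++ w)))) := by
  have h1 := greedyCount_le_append_left hp u (p ++ (v ++ (p ++ w)))
  have h2 := greedyCount_le_append_left hp v (p ++ w)
  rw [greedyCount_append_self hp] at h1 h2
  omega

theorem infix_of_greedyCount_pos {l : List A} (h : 0 < greedyCount p l) : p <:+: l := by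
  induction l with
  | nil => simp [greedyCount] at h
  | cons a t ih =>
    by_cases hp : p <+: a :: t
    · exact hp.isInfix
    · rw [greedyCount_cons_eq_tail hp] at h
      exact (ih h).trans (List.suffix_cons a t).isInfix

theorem greedyCount_le_count [BEq A] [LawfulBEq A] {c : A} (hc : c ∈ p) (l : List A) :
    greedyCount p l ≤ l.count c := by
  have hp : p ≠ [] := List.ne_nil_of_mem hc
  have hpos : 0 < p.length := List.length_pos_iff.2 hp
  induction hm : l.length using Nat.strong_induction_on generalizing l with
  | _ m ih =>
    subst hm
    by_cases h : p <+: l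
    · obtain ⟨r, rfl⟩ := h
      rw [greedyCount_append_self hp, List.count_append]
      have := ih r.length (by simp; omega) r rfl
      have := List.count_pos_iff.2 hc
      omega
    · cases l with
      | nil => simp [greedyCount]
      | cons a t =>
        rw [greedyCount_cons_eq_tail h]
        exact (ih t.length (by simp) t rfl).trans List.count_le_count_cons

end GreedyCount

namespace SLG

variable {T N : Type}

theorem exists_infix_of_rhsOccs_pos [Fintype N] [DecidableEq N] [DecidableEq T]
    {H : SLG T N} {s : List (N ⊕ T)} (h : 0 < H.rhsOccs s) : ∃ X, s <:+: H.rhs X := by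
  obtain ⟨X, -, hX⟩ := Finset.exists_ne_zero_of_sum_ne_zero h.ne'
  exact ⟨X, infix_of_greedyCount_pos (Nat.pos_of_ne_zero hX)⟩

/-- A longest repeated string is maximal. -/
theorem exists_isMaximal_of_two_le_rhsOccs [Fintype N] [DecidableEq N] [DecidableEq T]
    {H : SLG T N} {s : List (N ⊕ T)} (hs : 2 ≤ s.length) (h : 2 ≤ H.rhsOccs s) :
    ∃ s', H.IsMaximal s' := by
  classical
  let P : ℕ → Prop := fun m => ∃ u, u.length = m ∧ 2 ≤ H.rhsOccs u
  have bound : ∀ u, 2 ≤ H.rhsOccs u → u.length ≤ H.size := by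
    intro u hu
    obtain ⟨X, hX⟩ := exists_infix_of_rhsOccs_pos (Nat.lt_of_lt_of_le two_pos hu)
    exact hX.length_le.trans
      (Finset.single_le_sum (f := fun X => (H.rhs X).length) (fun _ _ => Nat.zero_le _)
        (Finset.mem_univ X))
  obtain ⟨u, hu, hu'⟩ : P (Nat.findGreatest P H.size) :=
    Nat.findGreatest_spec (bound s h) ⟨s, rfl, h⟩
  refine ⟨u, ?_, hu', fun v hv => ?_⟩
  · rw [hu]
    exact hs.trans (Nat.le_findGreatest (bound s h) ⟨s, rfl, h⟩)
  · by_contra! hle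
    have hv' := hu'.trans hle
    have : v.length ≤ Nat.findGreatest P H.size :=
      Nat.le_findGreatest (bound v hv') ⟨v, rfl, hv'⟩
    omega

/-- A self-recursive rule keeps a lone nonterminal from having an expansion. -/
theorem not_isExp_of_mem_rhs_self [Subsingleton N] {G : SLG T N} {X : N}
    (h : Sum.inl X ∈ G.rhs X) (u : List T) : ¬ G.IsExp X u := by
  intro hu
  have key : ∀ x, G.Derives [Sum.inl X] x → Sum.inl X ∈ x := by
    intro x hx
    induction hx with
    | refl => simp
    | tail _ hstep _ =>
      obtain ⟨p, q, Y, -, rfl⟩ := hstep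
      obtain rfl := Subsingleton.elim X Y
      simp [h]
  simpa using key _ hu

end SLG

section MaximalStrings

variable {T N : Type} {n : ℕ} {G : SLG T N} {e : Fin n ≃ N} {I : Finset (Fin n)}

theorem bexpFuel_succ_ne_nil (hG : G.Admissible) (k : ℕ) (s : N ⊕ T) :
    bexpFuel G e I (k + 1) s ≠ [] := by
  cases s with
  | inr t => simp [bexpFuel]
  | inl X =>
    obtain ⟨A, B, hAB⟩ := List.length_eq_two.1 (hG.1 X)
    by_cases h : e.symm X ∈ I <;> simp [bexpFuel, h, hAB]

theorem two_le_length_bexp (hG : G.Admissible) {expn : N → List T}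
    (hexpn : ∀ X, G.IsExp X (expn X)) {i : Fin n} (hi : i ∉ I) :
    2 ≤ (bexp G e I (Sum.inl (e i))).length := by
  obtain ⟨A, B, hAB⟩ := List.length_eq_two.1 (hG.1 (e i))
  obtain ⟨k, rfl⟩ : ∃ k, n = k + 1 := ⟨n - 1, by have := i.isLt; omega⟩
  have hA : bexpFuel G e I k A ≠ [] := by
    cases k with
    | succ k => exact bexpFuel_succ_ne_nil hG k A
    | zero =>
      cases A with
      | inr t => simp [bexpFuel]
      | inl X =>
        have : Subsingleton N :=
          @Equiv.subsingleton _ _ e.symm (inferInstanceAs (Subsingleton (Fin 1)))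
        obtain rfl := Subsingleton.elim X (e i)
        exact absurd (hexpn (e i)) (SLG.not_isExp_of_mem_rhs_self (by simp [hAB]) _)
  have := List.length_pos_iff.2 hA
  simp [bexp, bexpFuel, hi, hAB]
  omega

theorem two_le_rhsOccs_bexp [DecidableEq T] (i : Fin n)
    (h : bexp G e I (Sum.inl (e i)) ≠ []) :
    2 ≤ (GI G e I).rhsOccs (bexp G e I (Sum.inl (e i))) := by
  obtain ⟨l, r, hlr⟩ := List.append_of_mem (List.mem_finRange i)
  refine le_trans ?_ (Finset.single_le_sum
    (f := fun X => greedyCount (bexp G e I (Sum.inl (e i))) ((GI G e I).rhs X))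
    (fun _ _ => Nat.zero_le _) (Finset.mem_univ none))
  simp only [GI, hlr, List.flatMap_append, List.flatMap_cons, List.append_assoc,
    List.cons_append]
  exact two_le_greedyCount h _ [_] _

theorem bexp_inl_univ (i : Fin n) (X : N) :
    bexp G e Finset.univ (Sum.inl X) =
      [Sum.inl (some ⟨e.symm X, Finset.mem_univ _⟩)] := by
  cases n with
  | zero => exact i.elim0
  | succ k => simp [bexp, bexpFuel]

/-- The symbols of the grammar `G_I`. -/
abbrev GISymbol (T : Type) (I : Finset (Fin n)) : Type :=
  (Option {i : Fin n // i ∈ I}) ⊕ (T ⊕ Fin n ⊕ Fin (2 * n))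

/-- The dollar and hash symbols. -/
def IsSeparator (s : GISymbol T I) : Prop :=
  ∃ d, s = Sum.inr (Sum.inr d)

theorem bexp_univ (i : Fin n) (s : N ⊕ T) :
    ∃ c, ¬ IsSeparator c ∧ bexp G e Finset.univ s = [c] := by
  cases s with
  | inl X => exact ⟨_, by simp [IsSeparator], bexp_inl_univ i X⟩
  | inr t => exact ⟨Sum.inr (Sum.inl t), by simp [IsSeparator], by simp [bexp, bexpFuel]⟩

theorem GI_univ_rhs_some (hG : G.Admissible) (j : {i : Fin n // i ∈ Finset.univ}) :
    ∃ a b, ¬ IsSeparator a ∧ ¬ IsSeparator b ∧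
      (GI G e Finset.univ).rhs (some j) = [a, Sum.inr (Sum.inr (Sum.inl j.1)), b] := by
  obtain ⟨A, B, hAB⟩ := List.length_eq_two.1 (hG.1 (e j.1))
  obtain ⟨a, ha, hA⟩ := bexp_univ (G := G) (e := e) j.1 A
  obtain ⟨b, hb, hB⟩ := bexp_univ (G := G) (e := e) j.1 B
  exact ⟨a, b, ha, hb, by simp [GI, hAB, hA, hB]⟩

theorem isChain_GI_univ_rhs (hG : G.Admissible) (X : Option {i : Fin n // i ∈ Finset.univ}) :
    ((GI G e Finset.univ).rhs X).IsChain fun a b => IsSeparator a ∨ IsSeparator b := by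
  cases X with
  | some j =>
    obtain ⟨a, b, -, -, h⟩ := GI_univ_rhs_some (e := e) hG j
    rw [h]
    simp [IsSeparator]
  | none =>
    simp only [GI]
    induction List.finRange n with
    | nil => simp
    | cons i t ih =>
      rw [List.flatMap_cons, bexp_inl_univ i]
      generalize (List.flatMap _ t) = r at ih
      cases r <;> simp_all [IsSeparator]

theorem count_GI_univ_some [BEq (GISymbol T (Finset.univ (α := Fin n)))]
    [LawfulBEq (GISymbol T (Finset.univ (α := Fin n)))] (hG : G.Admissible)
    (d : Fin n ⊕ Fin (2 * n)) (j : {i : Fin n // i ∈ Finset.univ}) :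
    ((GI G e Finset.univ).rhs (some j)).count (Sum.inr (Sum.inr d)) =
      if d = Sum.inl j.1 then 1 else 0 := by
  obtain ⟨a, b, ha, hb, h⟩ := GI_univ_rhs_some (e := e) hG j
  have ha' : a ≠ Sum.inr (Sum.inr d) := fun h => ha ⟨d, h⟩
  have hb' : b ≠ Sum.inr (Sum.inr d) := fun h => hb ⟨d, h⟩
  rw [h]
  simp [List.count_cons, ha', hb', @eq_comm _ d]

theorem count_dollar_GI_univ_none [BEq (GISymbol T (Finset.univ (α := Fin n)))]
    [LawfulBEq (GISymbol T (Finset.univ (α := Fin n)))] (j : Fin n) :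
    ((GI G e Finset.univ).rhs none).count (Sum.inr (Sum.inr (Sum.inl j))) = 0 := by
  simp [GI, List.count_flatMap, Function.comp_def, bexp_inl_univ j]

theorem count_hash_GI_univ_none_le [BEq (GISymbol T (Finset.univ (α := Fin n)))]
    [LawfulBEq (GISymbol T (Finset.univ (α := Fin n)))] (j : Fin (2 * n)) :
    ((GI G e Finset.univ).rhs none).count (Sum.inr (Sum.inr (Sum.inr j))) ≤ 1 := by
  have hj : j.1 / 2 < n := by have := j.isLt; omega
  simp only [GI, List.count_flatMap, bexp_inl_univ (⟨j.1 / 2, hj⟩ : Fin n)]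
  rw [← List.ofFn_eq_map, List.sum_ofFn]
  calc _ ≤ ∑ i : Fin n, if i = ⟨j.1 / 2, hj⟩ then 1 else 0 := by
        refine Finset.sum_le_sum fun i _ => ?_
        simp only [Function.comp, List.cons_append, List.nil_append, List.count_cons,
          List.count_nil, beq_iff_eq, reduceCtorEq, if_false, Sum.inr.injEq, Fin.ext_iff]
        split_ifs <;> omega
    _ = 1 := by simp

theorem sum_count_separator_GI_univ_le [BEq (GISymbol T (Finset.univ (α := Fin n)))]
    [LawfulBEq (GISymbol T (Finset.univ (α := Fin n)))] (hG : G.Admissible)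
    (d : Fin n ⊕ Fin (2 * n)) :
    ∑ X, ((GI G e Finset.univ).rhs X).count (Sum.inr (Sum.inr d)) ≤ 1 := by
  rw [Fintype.sum_option]
  simp only [count_GI_univ_some hG]
  cases d with
  | inr j => simpa using count_hash_GI_univ_none_le j
  | inl j =>
    rw [count_dollar_GI_univ_none, zero_add, Finset.sum_eq_single ⟨j, Finset.mem_univ j⟩]
    · simp
    · rintro ⟨i, _⟩ - hi
      simp_all [eq_comm]
    · simp

theorem rhsOccs_GI_univ_le [DecidableEq T] (hG : G.Admissible)
    {s : List (GISymbol T (Finset.univ (α := Fin n)))}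
    (hs : 2 ≤ s.length) : (GI G e Finset.univ).rhsOccs s ≤ 1 := by
  rcases Nat.eq_zero_or_pos ((GI G e Finset.univ).rhsOccs s) with h | h
  · omega
  obtain ⟨X, u, v, huv⟩ := SLG.exists_infix_of_rhsOccs_pos h
  have hc := isChain_GI_univ_rhs (e := e) hG X
  rw [← huv] at hc
  replace hc := hc.left_of_append.right_of_append
  obtain ⟨d, hd⟩ : ∃ d, Sum.inr (Sum.inr d) ∈ s := by
    match s, hs with
    | a :: b :: t, _ =>
      rcases (List.isChain_cons_cons.1 hc).1 with ⟨d, rfl⟩ | ⟨d, rfl⟩ <;> exact ⟨d, by simp⟩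
  let : BEq (GISymbol T (Finset.univ (α := Fin n))) := instBEqOfDecidableEq
  exact (Finset.sum_le_sum fun X _ => greedyCount_le_count hd _).trans
    (sum_count_separator_GI_univ_le hG d)

end MaximalStrings

/-- Let `I ⊆ {1, …, |V|}`.  There exists a maximal string with respect
to the grammar `G_I` if and only if `I ≠ {1, …, |V|}`. -/
theorem maximal_string_exists_iff {T N : Type} [DecidableEq T] [Fintype N] {n : ℕ}
    (e : Fin n ≃ N) (G : SLG T N) (hG : G.Admissible)
    (expn : N → List T) (hexpn : ∀ X, G.IsExp X (expn X))
    (hord : ∀ i j : Fin n, i ≤ j → (expn (e i)).length ≤ (expn (e j)).length)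
    (I : Finset (Fin n)) :
    (∃ s, (GI G e I).IsMaximal s) ↔ I ≠ Finset.univ := by
  constructor
  · rintro ⟨s, hs, hocc, -⟩ rfl
    have := rhsOccs_GI_univ_le (e := e) hG hs
    omega
  · intro hI
    obtain ⟨i, hi⟩ : ∃ i, i ∉ I := by simpa [Finset.eq_univ_iff_forall] using hI
    have hlen := two_le_length_bexp (e := e) hG hexpn hi
    exact SLG.exists_isMaximal_of_two_le_rhsOccs hlen
      (two_le_rhsOccs_bexp i (List.length_pos_iff.1 (by omega)))
end

section
/- Let G_in = (V_in, Σ_in, R_in, S_in) be an SLG and let s ∈ (V_in ∪ Σ_in)^+ be maximal with respect to G_in, and assume that any two occurrences of s on the right-hand side of G_in are non-overlapping. Let G_aux = (V_in ∪ {X_aux}, Σ_in, R_aux, S_in) be an SLG where X_aux ∉ V_in ∪ Σ_in, such that: (1) the rule of X_aux in G_aux is X_aux → s; and (2) for every Y ∈ V_in, sub(rhs_{G_aux}(Y), X_aux, s) = rhs_{G_in}(Y) and s has no occurrence in rhs_{G_aux}(Y). Then the output of a single step of any global algorithm on G_in, using s as the maximal string, is isomorphic to G_aux. -/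
section Occurrences

variable {A : Type}

/-- The set of starting positions (0-indexed) of occurrences of `p` as a substring of `t`. -/
def occSet [DecidableEq A] (p t : List A) : Finset ℕ :=
  (Finset.range (t.length + 1)).filter fun q =>
    q + p.length ≤ t.length ∧ (t.drop q).take p.length = p

/-- Any two occurrences of `p` in `t` are non-overlapping. -/
def PairwiseNonOverlap [DecidableEq A] (p t : List A) : Prop :=
  ∀ q₁ ∈ occSet p t, ∀ q₂ ∈ occSet p t, q₁ < q₂ → q₁ + p.length ≤ q₂

end Occurrences

/-- Substitution of the fresh nonterminal (`none : Option N`) by the string `s`, leaving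
all other symbols unchanged; applied via `flatMap` it realises `sub(u, X_aux, s)`. -/
def unfreshSubst {T N : Type} (s : List (N ⊕ T)) : (Option N ⊕ T) → List (N ⊕ T)
  | Sum.inl none => s
  | Sum.inl (some X) => [Sum.inl X]
  | Sum.inr t => [Sum.inr t]

theorem mem_occSet_of_eq_append {A : Type} [DecidableEq A] {p t a b : List A}
    (h : t = a ++ (p ++ b)) : a.length ∈ occSet p t := by
  subst h
  simp only [occSet, Finset.mem_filter, Finset.mem_range, List.length_append]
  exact ⟨by omega, by omega, by simp⟩

/-- A prefix of `u.flatMap (unfreshSubst s)` either comes from a prefix of `u`, or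
it reaches past the first occurrence of the fresh nonterminal in `u`. -/
theorem prefix_or_fresh_of_prefix_flatMap {T N : Type} (s : List (N ⊕ T)) :
    ∀ (u : List (Option N ⊕ T)) (p : List (N ⊕ T)), p <+: u.flatMap (unfreshSubst s) →
      p.map (Sum.map some id) <+: u ∨
      ∃ (v : List (N ⊕ T)) (r : List (Option N ⊕ T)),
        u = v.map (Sum.map some id) ++ Sum.inl none :: r ∧ v.length < p.length := by
  intro u
  induction u with
  | nil => intro p hp; simp_all
  | cons c u ih =>
    intro p hp
    cases p with
    | nil => simp
    | cons x p =>
      have key : ∀ y : N ⊕ T, c = Sum.map some id y → unfreshSubst s c = [y] →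
          (x :: p).map (Sum.map some id) <+: c :: u ∨
          ∃ (v : List (N ⊕ T)) (r : List (Option N ⊕ T)),
            c :: u = v.map (Sum.map some id) ++ Sum.inl none :: r ∧
              v.length < (x :: p).length := by
        intro y hc hy
        rw [List.flatMap_cons, hy, List.singleton_append, List.cons_prefix_cons] at hp
        obtain ⟨rfl, hp⟩ := hp
        rcases ih p hp with h | ⟨v, r, rfl, hlt⟩
        · left
          rw [List.map_cons, List.cons_prefix_cons]
          exact ⟨hc.symm, h⟩
        · exact Or.inr ⟨x :: v, r, by simp [hc], by simpa using hlt⟩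
      rcases c with (_ | X) | t
      · exact Or.inr ⟨[], u, rfl, by simp⟩
      · exact key (Sum.inl X) rfl rfl
      · exact key (Sum.inr t) rfl rfl

theorem flatMap_unfreshSubst_map_some {T N : Type} (s v : List (N ⊕ T)) :
    (v.map (Sum.map some id)).flatMap (unfreshSubst s) = v := by
  induction v with
  | nil => rfl
  | cons x v ih =>
    rw [List.map_cons, List.flatMap_cons, ih]
    rcases x with X | t <;> rfl

/-- The greedy replacement of `s` recovers `u` from `u.flatMap (unfreshSubst s)` when `s` does
not occur in `u` and the occurrences of `s` in the substituted string do not overlap. -/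
theorem greedyReplace_flatMap_unfreshSubst {T N : Type} [DecidableEq T] [DecidableEq N]
    (s : List (N ⊕ T)) (hs : s ≠ []) (u : List (Option N ⊕ T))
    (hno : ¬ s.map (Sum.map some id) <:+: u)
    (hnov : ∀ x a c d : List (N ⊕ T), u.flatMap (unfreshSubst s) = x ++ (s ++ c) →
      u.flatMap (unfreshSubst s) = (x ++ a) ++ (s ++ d) → a ≠ [] → s.length ≤ a.length) :
    greedyReplace s (Sum.inl none) (Sum.map some id) (u.flatMap (unfreshSubst s)) = u := by
  induction u with
  | nil => simp [greedyReplace]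
  | cons c u ih =>
    have ih' := ih (fun h => hno (List.infix_cons h)) (fun x a c' d h₁ h₂ =>
      hnov (unfreshSubst s c ++ x) a c' d (by simp [List.flatMap_cons, h₁])
        (by rw [List.flatMap_cons, h₂]; simp))
    have key : ∀ y : N ⊕ T, c = Sum.map some id y → unfreshSubst s c = [y] →
        greedyReplace s (Sum.inl none) (Sum.map some id)
          ((c :: u).flatMap (unfreshSubst s)) = c :: u := by
      intro y hc hy
      have hpre : ¬ s <+: (c :: u).flatMap (unfreshSubst s) := by
        intro hp
        rcases prefix_or_fresh_of_prefix_flatMap s _ s hp with h | ⟨v, r, hu, hlt⟩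
        · exact hno h.isInfix
        · obtain ⟨b, hb⟩ := hp
          have hv : v ≠ [] := by
            rintro rfl
            rcases y with Y | t <;> simp_all
          have := hnov [] v b (r.flatMap (unfreshSubst s)) hb.symm
            (by rw [hu, List.flatMap_append, flatMap_unfreshSubst_map_some]; rfl) hv
          omega
      rw [List.flatMap_cons, hy, List.singleton_append] at hpre ⊢
      rw [greedyReplace, if_neg (fun h => hpre h.2), ih', hc]
    rcases c with (_ | X) | t
    · obtain ⟨y, s', rfl⟩ := List.exists_cons_of_ne_nil hs
      have e : (Sum.inl none :: u).flatMap (unfreshSubst (y :: s')) =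
          y :: (s' ++ u.flatMap (unfreshSubst (y :: s'))) := rfl
      rw [e, greedyReplace, if_pos ⟨hs, by simp⟩]
      simp only [List.length_cons, Nat.add_sub_cancel, List.drop_left, ih']
    · exact key (Sum.inl X) rfl rfl
    · exact key (Sum.inr t) rfl rfl

/-- Let `G_in` be an SLG and `s` a maximal string with respect to
`G_in` whose occurrences on the right-hand side of `G_in` are pairwise non-overlapping.
Let `G_aux` extend `G_in` by one fresh nonterminal `X_aux` (modelled by `none : Option N`)
with the same start symbol, such that `rhs_{G_aux}(X_aux) = s`,
`sub(rhs_{G_aux}(Y), X_aux, s) = rhs_{G_in}(Y)` and `s` has no occurrence in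
`rhs_{G_aux}(Y)` for every `Y ∈ V_in`.  Then the output of a single step of any global
algorithm on `G_in`, using `s` as the maximal string, is isomorphic to `G_aux`. -/
theorem global_single_step {T N : Type} [DecidableEq T] [DecidableEq N] [Fintype N]
    (Gin : SLG T N) (s : List (N ⊕ T))
    (hmax : Gin.IsMaximal s)
    (hnov : ∀ X, PairwiseNonOverlap s (Gin.rhs X))
    (Gaux : SLG T (Option N))
    (hstart : Gaux.start = some Gin.start)
    (hfresh : Gaux.rhs none = s.map (Sum.map some id))
    (hsub : ∀ Y : N, (Gaux.rhs (some Y)).flatMap (unfreshSubst s) = Gin.rhs Y)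
    (hnoocc : ∀ Y : N, occSet (s.map (Sum.map some id)) (Gaux.rhs (some Y)) = ∅) :
    (Gin.globalStep s).Isomorphic Gaux := by
  have hs : s ≠ [] := by
    rintro rfl
    simp [SLG.IsMaximal] at hmax
  have hrhs : ∀ Y : N,
      greedyReplace s (Sum.inl none) (Sum.map some id) (Gin.rhs Y) = Gaux.rhs (some Y) := by
    intro Y
    rw [← hsub Y]
    refine greedyReplace_flatMap_unfreshSubst s hs _ ?_ ?_
    · rintro ⟨a, b, h⟩
      have := mem_occSet_of_eq_append (p := s.map (Sum.map some id))
        (by rw [← h, List.append_assoc] : Gaux.rhs (some Y) = a ++ (_ ++ b))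
      rw [hnoocc Y] at this
      simp at this
    · intro x a c d h₁ h₂ ha
      have hpos := List.length_pos_of_ne_nil ha
      rw [hsub Y] at h₁ h₂
      have := hnov Y _ (mem_occSet_of_eq_append h₁) _ (mem_occSet_of_eq_append h₂)
        (by rw [List.length_append]; omega)
      rw [List.length_append] at this
      omega
  refine ⟨Equiv.refl _, hstart.symm, ?_⟩
  rintro (_ | Y)
  · simp [SLG.globalStep, hfresh]
  · simp [SLG.globalStep, hrhs]
end
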